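/- For all integers x ≥ 2 and y ≥ 2, π(x)·π(y) ≤ (9/16)·π(x+y)², where π is the prime-counting function. -/

import Mathlib

open Finset Real

open ArithmeticFunction (vonMangoldt)

theorem log_factorial_eq_sum_vonMangoldt {n N : ℕ} (h : n ≤ N) :
    log n.factorial = ∑ d ∈ Ioc 0 N, vonMangoldt d * (n / d : ℕ) := by
  induction n with
  | zero => simp
  | succ n ih =>
    have hdiv : log (n + 1 : ℕ) = ∑ d ∈ Ioc 0 N, vonMangoldt d * (if d ∣ n + 1 then 1 else 0) := by
      rw [← ArithmeticFunction.vonMangoldt_sum]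
      simp only [mul_ite, mul_one, mul_zero]
      rw [← Finset.sum_filter]
      refine Finset.sum_congr ?_ fun _ _ => rfl
      ext d
      simp only [Nat.mem_divisors, mem_filter, mem_Ioc]
      exact ⟨fun h' => ⟨⟨Nat.pos_of_dvd_of_pos h'.1 n.succ_pos,
        (Nat.le_of_dvd n.succ_pos h'.1).trans h⟩, h'.1⟩, fun h' => ⟨h'.2, n.succ_ne_zero⟩⟩
    rw [Nat.factorial_succ, Nat.cast_mul, log_mul (by positivity) (by positivity), ih (by omega), hdiv,
      ← Finset.sum_add_distrib]
    refine Finset.sum_congr rfl fun d _ => ?_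
    rw [Nat.succ_div]
    split_ifs <;> push_cast <;> ring

/-- Chebyshev's combination `log (n! ⌊n/30⌋! / (⌊n/2⌋! ⌊n/3⌋! ⌊n/5⌋!))`. -/
noncomputable def chebyshevCombination (n : ℕ) : ℝ :=
  log n.factorial + log (n / 30).factorial - log (n / 2).factorial - log (n / 3).factorial -
    log (n / 5).factorial

theorem chebyshevCombination_eq_sum (n : ℕ) :
    chebyshevCombination n = ∑ d ∈ Ioc 0 n, vonMangoldt d *
      ((n / d : ℕ) + (n / d / 30 : ℕ) - (n / d / 2 : ℕ) - (n / d / 3 : ℕ) - (n / d / 5 : ℕ)) := by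
  have key (k : ℕ) : log (n / k).factorial = ∑ d ∈ Ioc 0 n, vonMangoldt d * (n / d / k : ℕ) := by
    rw [log_factorial_eq_sum_vonMangoldt (Nat.div_le_self n k)]
    refine Finset.sum_congr rfl fun d _ => ?_
    rw [Nat.div_div_eq_div_mul, Nat.div_div_eq_div_mul, mul_comm k d]
  simp only [chebyshevCombination, key, log_factorial_eq_sum_vonMangoldt le_rfl, mul_sub, mul_add,
    Finset.sum_sub_distrib, Finset.sum_add_distrib]

theorem chebyshevCombination_le_psi (n : ℕ) : chebyshevCombination n ≤ Chebyshev.psi n := by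
  rw [chebyshevCombination_eq_sum, Chebyshev.psi, Nat.floor_natCast]
  refine Finset.sum_le_sum fun d _ => mul_le_of_le_one_right ArithmeticFunction.vonMangoldt_nonneg ?_
  have : n / d + n / d / 30 ≤ 1 + n / d / 2 + n / d / 3 + n / d / 5 := by omega
  have : ((n / d + n / d / 30 : ℕ) : ℝ) ≤ (1 + n / d / 2 + n / d / 3 + n / d / 5 : ℕ) := by
    exact_mod_cast this
  push_cast at this
  linarith

theorem psi_sub_psi_le_chebyshevCombination (n : ℕ) :
    Chebyshev.psi n - Chebyshev.psi (n / 6 : ℕ) ≤ chebyshevCombination n := by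
  have hsplit : Chebyshev.psi n - Chebyshev.psi (n / 6 : ℕ) =
      ∑ d ∈ Ioc 0 n, vonMangoldt d * (if n / 6 < d then 1 else 0) := by
    simp only [Chebyshev.psi, Nat.floor_natCast, mul_ite, mul_one, mul_zero]
    rw [← Finset.sum_filter, sub_eq_iff_eq_add,
      ← Finset.sum_filter_add_sum_filter_not (Ioc 0 n) (n / 6 < ·)]
    congr 1
    refine Finset.sum_congr ?_ fun _ _ => rfl
    ext d
    simp only [mem_filter, mem_Ioc]
    omega
  rw [hsplit, chebyshevCombination_eq_sum]
  refine Finset.sum_le_sum fun d hd =>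
    mul_le_mul_of_nonneg_left ?_ ArithmeticFunction.vonMangoldt_nonneg
  have hd' := Finset.mem_Ioc.1 hd
  have h₁ : n / d / 2 + n / d / 3 + n / d / 5 + (if n / 6 < d then 1 else 0) ≤
      n / d + n / d / 30 := by
    split_ifs with h
    · have : 1 ≤ n / d := (Nat.one_le_div_iff hd'.1).2 hd'.2
      have : n / d < 6 := Nat.div_lt_of_lt_mul (by omega)
      omega
    · omega
  have h₂ : ((n / d / 2 + n / d / 3 + n / d / 5 + (if n / 6 < d then 1 else 0) : ℕ) : ℝ) ≤
      (n / d + n / d / 30 : ℕ) := by exact_mod_cast h₁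
  push_cast at h₂
  linarith

theorem log_factorial_le {n : ℕ} (hn : 1 ≤ n) : log n.factorial ≤ n * log n - n + log n + 1 := by
  induction n, hn using Nat.le_induction with
  | base => simp
  | succ n hn ih =>
    have hn' : (0 : ℝ) < n := by exact_mod_cast hn
    have h := one_sub_inv_le_log_of_pos (x := ((n + 1 : ℝ) / n)) (by positivity)
    rw [log_div (by positivity) (by positivity)] at h
    have h₂ : 1 - ((n + 1 : ℝ) / n)⁻¹ = 1 / (n + 1) := by field_simp; ring
    rw [h₂, div_le_iff₀ (by positivity)] at h
    rw [Nat.factorial_succ, Nat.cast_mul, log_mul (by positivity) (by positivity)]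
    push_cast
    nlinarith

theorem le_log_factorial_succ (n : ℕ) :
    (n + 1 : ℝ) * log (n + 1) - n - log (n + 1) ≤ log n.factorial := by
  induction n with
  | zero => simp
  | succ n ih =>
    have h := log_le_sub_one_of_pos (x := ((n + 2 : ℝ) / (n + 1))) (by positivity)
    rw [log_div (by positivity) (by positivity)] at h
    have h₂ : ((n + 2 : ℝ) / (n + 1)) - 1 = 1 / (n + 1) := by field_simp; ring
    rw [h₂, le_div_iff₀ (by positivity)] at h
    rw [Nat.factorial_succ, Nat.cast_mul, log_mul (by positivity) (by positivity)]
    push_cast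
    rw [show (n : ℝ) + 1 + 1 = n + 2 by ring]
    nlinarith

theorem mul_log_sub_self_le {x y : ℝ} (hx : 1 ≤ x) (hxy : x ≤ y) :
    x * log x - x ≤ y * log y - y := by
  have hy : 0 < y := by linarith
  have h := one_sub_inv_le_log_of_pos (x := y / x) (by positivity)
  rw [log_div (by linarith) (by linarith), inv_div, sub_le_iff_le_add, ← sub_le_iff_le_add'] at h
  have h₂ : y * (x / y) = x := mul_div_cancel₀ x hy.ne'
  have := log_nonneg hx
  nlinarith [mul_le_mul_of_nonneg_left h (by linarith : 0 ≤ y)]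

theorem log_factorial_div_bounds {n k : ℕ} (hk : 0 < k) (h : k ≤ n) :
    (n / k : ℝ) * log (n / k : ℝ) - n / k - log (n / k : ℝ) ≤ log (n / k).factorial ∧
      log (n / k).factorial ≤ (n / k : ℝ) * log (n / k : ℝ) - n / k + log (n / k : ℝ) + 1 := by
  have hk' : (0 : ℝ) < k := by exact_mod_cast hk
  have hm : 1 ≤ n / k := (Nat.one_le_div_iff hk).2 h
  have hm' : (1 : ℝ) ≤ (n / k : ℕ) := by exact_mod_cast hm
  have hle : ((n / k : ℕ) : ℝ) ≤ (n / k : ℝ) := Nat.cast_div_le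
  have hlt : (n / k : ℝ) < (n / k : ℕ) + 1 := by
    rw [div_lt_iff₀ hk']
    exact_mod_cast Nat.lt_mul_of_div_lt (Nat.lt_succ_self (n / k)) hk
  generalize (n / k : ℝ) = x at *
  generalize n / k = m at *
  constructor
  · have h₁ := le_log_factorial_succ m
    have h₂ := mul_log_sub_self_le (by linarith : 1 ≤ x) hlt.le
    have h₃ : log (m + 1) ≤ 1 + log x := by
      have := log_le_sub_one_of_pos (x := (m + 1) / x) (div_pos (by positivity) (by linarith))
      rw [log_div (by positivity) (by linarith)] at this
      have : ((m : ℝ) + 1) / x ≤ 2 := by rw [div_le_iff₀ (by linarith)]; linarith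
      linarith
    linarith
  · have h₁ := log_factorial_le hm
    have h₂ := mul_log_sub_self_le hm' hle
    have h₃ := log_le_log (by linarith) hle
    linarith

theorem chebyshevCombination_bounds {n : ℕ} (hn : 30 ≤ n) :
    0.9212 * n - 5 * log n - 3 ≤ chebyshevCombination n ∧
      chebyshevCombination n ≤ 0.9213 * n + 5 * log n + 2 := by
  have hn' : (30 : ℝ) ≤ n := by exact_mod_cast hn
  have b1 := log_factorial_div_bounds (n := n) (k := 1) (by norm_num) (by omega)
  have b2 := log_factorial_div_bounds (n := n) (k := 2) (by norm_num) (by omega)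
  have b3 := log_factorial_div_bounds (n := n) (k := 3) (by norm_num) (by omega)
  have b5 := log_factorial_div_bounds (n := n) (k := 5) (by norm_num) (by omega)
  have b30 := log_factorial_div_bounds (n := n) (k := 30) (by norm_num) (by omega)
  have l30 : log 30 = log 2 + log 3 + log 5 := by
    rw [← log_mul (by norm_num) (by norm_num), ← log_mul (by norm_num) (by norm_num)]; norm_num
  push_cast at b1 b2 b3 b5 b30
  rw [log_div (by linarith) (by norm_num)] at b2 b3 b5 b30
  simp only [Nat.div_one, div_one] at b1
  rw [l30] at b30
  have := log_two_gt_d9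
  have := log_two_lt_d9
  have := log_three_gt_d9
  have := log_three_lt_d9
  have := log_five_gt_d9
  have := log_five_lt_d9
  have hl : 0 ≤ log n := log_nonneg (by linarith)
  unfold chebyshevCombination
  generalize log n = L at *
  generalize log 2 = a at *
  generalize log 3 = b at *
  generalize log 5 = c at *
  constructor <;> nlinarith

/-- The value of `primorial 317`. -/
def sieveModulus : ℕ :=
  19361386640700823163471425054312320082662897612571563761906962414215012369856637179096947335243680669607531475629148240284399976570

theorem sieveModulus_eq_primorial : sieveModulus = primorial 317 := by
  decide +kernel

theorem coprime_sieveModulus_iff_prime {n : ℕ} (h₁ : 317 < n) (h₂ : n < 317 * 317) :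
    n.gcd sieveModulus = 1 ↔ n.Prime := by
  rw [sieveModulus_eq_primorial]
  constructor
  · intro h
    by_contra hn
    have hlt : n.minFac ≤ 317 := by
      have := Nat.minFac_sq_le_self (by omega) hn
      nlinarith
    have hp : n.minFac.Prime := Nat.minFac_prime (by omega)
    have hd : n.minFac ∣ primorial 317 := hp.dvd_primorial_iff.2 hlt
    have := Nat.dvd_gcd n.minFac_dvd hd
    rw [h] at this
    exact hp.one_lt.ne' (Nat.dvd_one.1 this)
  · intro hp
    refine (Nat.Prime.coprime_iff_not_dvd hp).2 fun h => ?_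
    have := hp.dvd_primorial_iff.1 h
    omega

/-- Starting from `c = π (M - k)`, checks that `7 π(n) ≤ n + 194` and `2 n + 776 ≤ 21 π(n)` hold
for `M - k ≤ n < M` and that `π M = e`, sieving with `sieveModulus`. The positive count is matched on so
that kernel reduction keeps it in normal form. -/
def checkLinearBounds (M e : ℕ) : ℕ → ℕ → Bool
  | 0, c => c == e
  | _ + 1, 0 => false
  | k + 1, c + 1 =>
    Nat.ble (7 * (c + 1)) (M - (k + 1) + 194) && (Nat.ble (2 * (M - (k + 1)) + 776) (21 * (c + 1)) &&
      checkLinearBounds M e k (bif Nat.beq (Nat.gcd (M - k) sieveModulus) 1 then c + 2 else c + 1))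

theorem primeCounting_succ (n : ℕ) :
    Nat.primeCounting (n + 1) = Nat.primeCounting n + if (n + 1).Prime then 1 else 0 := by
  simp [Nat.primeCounting, Nat.primeCounting', Nat.count_succ]

theorem linear_bounds_of_checkLinearBounds {M e : ℕ} (hM : M < 317 * 317) (k c : ℕ)
    (hk : 317 + k ≤ M) (hc : Nat.primeCounting (M - k) = c)
    (h : checkLinearBounds M e k c = true) :
    Nat.primeCounting M = e ∧ ∀ n, M - k ≤ n → n < M →
      7 * Nat.primeCounting n ≤ n + 194 ∧ 2 * n + 776 ≤ 21 * Nat.primeCounting n := by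
  induction k generalizing c with
  | zero =>
    simp only [checkLinearBounds, beq_iff_eq] at h
    exact ⟨by simpa [h] using hc, fun n h₁ h₂ => by omega⟩
  | succ k ih =>
    cases c with
    | zero => simp [checkLinearBounds] at h
    | succ c =>
      simp only [checkLinearBounds, Bool.and_eq_true, Nat.ble_eq] at h
      obtain ⟨h₁, h₂, h₃⟩ := h
      have hs : M - k = M - (k + 1) + 1 := by omega
      have hcount := primeCounting_succ (M - (k + 1))
      rw [← hs, hc] at hcount
      have hiff := coprime_sieveModulus_iff_prime (n := M - k) (by omega) (by omega)
      obtain ⟨hl, hr⟩ := ih _ (by omega) (by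
        rw [hcount]
        by_cases hp : (M - k).Prime
        · have hg : Nat.beq (Nat.gcd (M - k) sieveModulus) 1 = true := by
            simpa using hiff.2 hp
          simp [hp, hg]
        · have hg : Nat.beq (Nat.gcd (M - k) sieveModulus) 1 = false := by
            have := mt hiff.1 hp
            simpa [← Bool.not_eq_true] using this
          simp [hp, hg]) h₃
      refine ⟨hl, fun n hn₁ hn₂ => ?_⟩
      rcases hn₁.eq_or_lt with rfl | hlt
      · rw [hc]; exact ⟨h₁, h₂⟩
      · exact hr n (by omega) hn₂

/-- Runs `checkLinearBounds` on consecutive intervals `[a, b]`, given `c = π a` and a list of pairs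
`(b, π b)`. -/
def checkLinearBoundsList (a c : ℕ) : List (ℕ × ℕ) → Bool
  | [] => true
  | (b, e) :: l => Nat.ble a b && (checkLinearBounds b e (b - a) c && checkLinearBoundsList b e l)

theorem linear_bounds_of_checkLinearBoundsList (l : List (ℕ × ℕ)) (a c : ℕ) (ha : 317 ≤ a)
    (hl : ∀ b ∈ l, b.1 < 317 * 317) (hc : Nat.primeCounting a = c)
    (h : checkLinearBoundsList a c l = true) :
    ∀ b ∈ l, Nat.primeCounting b.1 = b.2 ∧ ∀ n, a ≤ n → n < b.1 →
      7 * Nat.primeCounting n ≤ n + 194 ∧ 2 * n + 776 ≤ 21 * Nat.primeCounting n := by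
  induction l generalizing a c with
  | nil => simp
  | cons b l ih =>
    simp only [checkLinearBoundsList, Bool.and_eq_true, Nat.ble_eq] at h
    obtain ⟨h₁, h₂, h₃⟩ := h
    have hb := hl b (by simp)
    obtain ⟨he, hn⟩ := linear_bounds_of_checkLinearBounds hb _ _ (by omega)
      (by rwa [Nat.sub_sub_self h₁]) h₂
    rw [Nat.sub_sub_self h₁] at hn
    have key := ih b.1 b.2 (by omega) (fun b' hb' => hl b' (by simp [hb'])) he h₃
    intro b' hb'
    rcases List.mem_cons.1 hb' with rfl | hb'
    · exact ⟨he, hn⟩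
    · refine ⟨(key b' hb').1, fun n hn₁ hn₂ => ?_⟩
      rcases lt_or_ge n b.1 with hlt | hge
      · exact hn n hn₁ hlt
      · exact (key b' hb').2 n hge hn₂

/-- Pairs `(n, π n)`. -/
def primeCountingTable : List (ℕ × ℕ) :=
  [(2000, 303), (4000, 550), (6000, 783), (8000, 1007), (10000, 1229), (12000, 1438),
   (14000, 1652), (16000, 1862), (18000, 2064), (20000, 2262), (22000, 2464), (24000, 2668),
   (26000, 2860), (28000, 3055), (30000, 3245), (32000, 3432), (32768, 3512), (34000, 3638),
   (36000, 3824), (38000, 4017), (40000, 4203), (42000, 4392), (44000, 4579), (46000, 4761),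
   (48000, 4946), (50000, 5133), (52000, 5319), (54000, 5500), (56000, 5683), (58000, 5873),
   (60000, 6057), (62000, 6232), (64000, 6413), (66000, 6591), (68000, 6774), (70000, 6935),
   (72000, 7128), (74000, 7301), (76000, 7484), (78000, 7662), (80000, 7837), (82000, 8017),
   (84000, 8190), (86000, 8362), (88000, 8543), (90000, 8713), (92000, 8887), (94000, 9070),
   (96000, 9252), (98000, 9418), (100000, 9592)]

theorem primeCounting_359 : Nat.primeCounting 359 = 72 := by decide +kernel

theorem primeCountingTable_spec : ∀ b ∈ primeCountingTable, Nat.primeCounting b.1 = b.2 ∧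
    ∀ n, 359 ≤ n → n < b.1 →
      7 * Nat.primeCounting n ≤ n + 194 ∧ 2 * n + 776 ≤ 21 * Nat.primeCounting n :=
  linear_bounds_of_checkLinearBoundsList primeCountingTable 359 72 (by norm_num)
    (by decide +kernel) primeCounting_359 (by decide +kernel)

theorem primeCounting_linear_bounds {n : ℕ} (h₁ : 359 ≤ n) (h₂ : n < 100000) :
    7 * Nat.primeCounting n ≤ n + 194 ∧ 2 * n + 776 ≤ 21 * Nat.primeCounting n :=
  (primeCountingTable_spec (100000, 9592) (by decide +kernel)).2 n h₁ h₂

theorem primeCounting_32768 : Nat.primeCounting 32768 = 3512 :=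
  (primeCountingTable_spec (32768, 3512) (by decide +kernel)).1

theorem mul_le_sq_of_linear_bounds {q d a b c m : ℕ} (ha : q * a ≤ m + d) {n : ℕ}
    (hb : q * b ≤ n + d) (hc : 2 * (m + n + 2 * d) ≤ 3 * q * c) (hq : 0 < q) :
    16 * (a * b) ≤ 9 * c ^ 2 := by
  have h₁ : q * (2 * (a + b)) ≤ q * (3 * c) := by linarith
  have h₂ : 2 * (a + b) ≤ 3 * c := Nat.le_of_mul_le_mul_left h₁ hq
  zify at h₂ ⊢
  nlinarith [sq_nonneg ((a : ℤ) - b), pow_le_pow_left₀ (by positivity) h₂ 2]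

theorem primeCounting_linear_bounds_small :
    ∀ n < 359, (7 * Nat.primeCounting n ≤ n + 194 ∧ 4 * Nat.primeCounting n ≤ n + 13) ∧
      (20 ≤ n → n + 26 ≤ 6 * Nat.primeCounting n) := by
  decide +kernel

theorem primeCounting_mul_le_of_add_lt {x y : ℕ} (hx : 2 ≤ x) (hy : 2 ≤ y) (h : x + y < 100000) :
    16 * (Nat.primeCounting x * Nat.primeCounting y) ≤ 9 * Nat.primeCounting (x + y) ^ 2 := by
  rcases lt_or_ge (x + y) 359 with h₁ | h₁
  · rcases lt_or_ge (x + y) 20 with h₂ | h₂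
    · have key : ∀ x < 20, ∀ y < 20, 2 ≤ x → 2 ≤ y →
          16 * (Nat.primeCounting x * Nat.primeCounting y) ≤ 9 * Nat.primeCounting (x + y) ^ 2 := by decide +kernel
      exact key x (by omega) y (by omega) hx hy
    · refine mul_le_sq_of_linear_bounds (primeCounting_linear_bounds_small x (by omega)).1.2
        (primeCounting_linear_bounds_small y (by omega)).1.2 ?_ (by norm_num)
      have := (primeCounting_linear_bounds_small _ h₁).2 h₂
      omega
  · have upper (t : ℕ) (ht : t < 100000) : 7 * Nat.primeCounting t ≤ t + 194 := by
      rcases lt_or_ge t 359 with h₂ | h₂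
      · exact (primeCounting_linear_bounds_small t h₂).1.1
      · exact (primeCounting_linear_bounds h₂ ht).1
    refine mul_le_sq_of_linear_bounds (q := 7) (d := 194) (upper x (by omega))
      (upper y (by omega)) ?_ (by norm_num)
    linarith [(primeCounting_linear_bounds h₁ h).2]

/-- The product of the `n ∈ (a, a + 2 ^ k]` that are coprime to `sieveModulus`. -/
def sievedProd : ℕ → ℕ → ℕ
  | 0, a => bif Nat.beq (Nat.gcd (a + 1) sieveModulus) 1 then a + 1 else 1
  | k + 1, a => sievedProd k a * sievedProd k (a + 2 ^ k)

theorem sievedProd_eq_prod (k a : ℕ) :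
    sievedProd k a = ∏ n ∈ Ioc a (a + 2 ^ k) with n.gcd sieveModulus = 1, n := by
  rw [Finset.prod_filter]
  induction k generalizing a with
  | zero =>
    simp only [sievedProd, pow_zero, ← Finset.Icc_succ_left_eq_Ioc, Nat.succ_eq_succ,
      Nat.succ_eq_add_one, Finset.Icc_self, Finset.prod_singleton, Bool.cond_eq_ite, Nat.beq_eq]
  | succ k ih =>
    rw [sievedProd, ih, ih, Finset.prod_Ioc_consecutive _ (Nat.le_add_right _ _) (Nat.le_add_right _ _)]
    congr 2
    ring

theorem sieveModulus_mul_sievedProd_le_primorial {k : ℕ} (h : 2 ^ k < 317 * 317) (h' : 317 ≤ 2 ^ k) :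
    sieveModulus * sievedProd k 0 ≤ primorial (2 ^ k) := by
  rw [sievedProd_eq_prod, zero_add]
  have hprime : ∀ n ∈ (Ioc 0 (2 ^ k)).filter (fun n : ℕ => n.gcd sieveModulus = 1),
      n ≠ 1 → n.Prime ∧ 317 < n := by
    intro n hn h1
    simp only [mem_filter, mem_Ioc] at hn
    rcases lt_or_ge 317 n with hlt | hge
    · exact ⟨(coprime_sieveModulus_iff_prime hlt (by omega)).1 hn.2, hlt⟩
    · have hp := Nat.minFac_prime h1
      have hd : n.minFac ∣ sieveModulus := by
        rw [sieveModulus_eq_primorial, hp.dvd_primorial_iff]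
        exact (Nat.minFac_le hn.1.1).trans hge
      have := Nat.dvd_gcd n.minFac_dvd hd
      rw [hn.2] at this
      exact absurd (Nat.dvd_one.1 this) hp.one_lt.ne'
  rw [← Finset.prod_filter_ne_one (s := (Ioc 0 (2 ^ k)).filter (fun n : ℕ => n.gcd sieveModulus = 1))
    (f := fun n => n)]
  conv_lhs => arg 1; rw [sieveModulus_eq_primorial, primorial]
  rw [← Finset.prod_union]
  · refine Finset.prod_le_prod_of_subset_of_one_le' ?_ ?_
    · intro n hn
      simp only [mem_union, mem_filter, mem_range] at hn ⊢
      rcases hn with hn | hn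
      · exact ⟨by linarith [hn.1], hn.2⟩
      · have := hprime n (by simpa using hn.1) hn.2
        exact ⟨Nat.lt_succ_of_le (Finset.mem_Ioc.1 hn.1.1).2, this.1⟩
    · intro n hn _
      exact (Finset.mem_filter.1 hn).2.one_le
  · rw [Finset.disjoint_left]
    intro n hn hn'
    simp only [mem_filter, mem_range] at hn
    rw [Finset.mem_filter] at hn'
    linarith [hn.1, (hprime n hn'.1 hn'.2).2]

set_option exponentiation.threshold 50000 in
theorem two_pow_le_primorial_32768 : 2 ^ 46600 ≤ primorial 32768 := by
  have h : 46600 ≤ Nat.log2 (sieveModulus * sievedProd 15 0) := by decide +kernel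
  have h₀ : sieveModulus * sievedProd 15 0 ≠ 0 := by
    intro h₀
    simp [h₀] at h
  exact ((Nat.le_log2 h₀).1 h).trans
    (sieveModulus_mul_sievedProd_le_primorial (k := 15) (by norm_num) (by norm_num))

theorem theta_sub_theta_le_psi_sub_psi {x y : ℝ} (h : x ≤ y) :
    Chebyshev.theta y - Chebyshev.theta x ≤ Chebyshev.psi y - Chebyshev.psi x := by
  have : Chebyshev.psi x - Chebyshev.theta x ≤ Chebyshev.psi y - Chebyshev.theta y := by
    rw [Chebyshev.psi_sub_theta_eq_sum_not_prime, Chebyshev.psi_sub_theta_eq_sum_not_prime]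
    refine Finset.sum_le_sum_of_subset_of_nonneg ?_ fun _ _ _ => ArithmeticFunction.vonMangoldt_nonneg
    exact Finset.filter_subset_filter _ (Finset.Ioc_subset_Ioc_right (Nat.floor_mono h))
  linarith

theorem theta_le_of_theta_div_six_le {n : ℕ} {a : ℝ} (hn : 30 ≤ n) (ha : 0 ≤ a)
    (h : Chebyshev.theta (n / 6 : ℕ) ≤ a * (n / 6 : ℕ)) :
    Chebyshev.theta n ≤ (a / 6 + 0.9213) * n + 5 * log n + 2 := by
  have h₁ := psi_sub_psi_le_chebyshevCombination n
  have h₂ := (chebyshevCombination_bounds hn).2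
  have h₃ := theta_sub_theta_le_psi_sub_psi (x := (n / 6 : ℕ)) (y := n)
    (by exact_mod_cast Nat.div_le_self n 6)
  have h₄ : ((n / 6 : ℕ) : ℝ) ≤ (n : ℝ) / (6 : ℕ) := Nat.cast_div_le
  push_cast at h₄
  nlinarith

theorem log_le_div_two_pow {x : ℝ} (hx : 0 < x) (k : ℕ) :
    log x ≤ x / 2 ^ k - 1 + k * log 2 := by
  have := log_le_sub_one_of_pos (x := x / 2 ^ k) (by positivity)
  rw [log_div hx.ne' (by positivity), log_pow] at this
  linarith

theorem theta_le {n : ℕ} (hn : 32768 ≤ n) : Chebyshev.theta n ≤ 1.112 * n := by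
  have hl := log_two_lt_d9
  have l4 : log 4 = 2 * log 2 := by
    rw [show (4 : ℝ) = 2 ^ 2 by norm_num, log_pow]; norm_num
  have step₁ (m : ℕ) (hm : 910 ≤ m) : Chebyshev.theta m ≤ 1.1924 * m := by
    have hm' : (910 : ℝ) ≤ m := by exact_mod_cast hm
    have h := theta_le_of_theta_div_six_le (a := log 4) (by omega) (log_nonneg (by norm_num))
      (Chebyshev.theta_le_log4_mul_x (Nat.cast_nonneg (m / 6)))
    have h' := log_le_div_two_pow (by linarith : (0 : ℝ) < m) 10
    rw [l4] at h
    norm_num at h h' ⊢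
    nlinarith
  have step₂ (m : ℕ) (hm : 5460 ≤ m) : Chebyshev.theta m ≤ 1.1291 * m := by
    have hm' : (5460 : ℝ) ≤ m := by exact_mod_cast hm
    have h := theta_le_of_theta_div_six_le (by omega) (by norm_num) (step₁ (m / 6) (by omega))
    have h' := log_le_div_two_pow (by linarith : (0 : ℝ) < m) 12
    norm_num at h h' ⊢
    linarith
  have hn' : (32768 : ℝ) ≤ n := by exact_mod_cast hn
  have h := theta_le_of_theta_div_six_le (by omega) (by norm_num) (step₂ (n / 6) (by omega))
  have h' := log_le_div_two_pow (by linarith : (0 : ℝ) < n) 15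
  norm_num at h h' ⊢
  linarith

theorem theta_succ (n : ℕ) : Chebyshev.theta (n + 1 : ℕ) =
    Chebyshev.theta n + if (n + 1).Prime then log (n + 1 : ℕ) else 0 := by
  simp only [Chebyshev.theta, Nat.floor_natCast, Finset.sum_filter]
  rw [Finset.sum_Ioc_succ_top (Nat.zero_le n)]

theorem primeCounting_mul_log_sub_theta_le {n : ℕ} (hn : 32768 ≤ n) :
    Nat.primeCounting n * log n - Chebyshev.theta n ≤ 0.13 * n := by
  have hl := log_two_gt_d9
  have l15 : log 32768 = 15 * log 2 := by
    rw [show (32768 : ℝ) = 2 ^ 15 by norm_num, log_pow]; norm_num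
  induction n, hn using Nat.le_induction with
  | base =>
    have h : (46600 : ℕ) * log 2 ≤ Chebyshev.theta (32768 : ℕ) := by
      rw [Chebyshev.theta_eq_log_primorial, Nat.floor_natCast, ← log_pow]
      exact log_le_log (by positivity) (by exact_mod_cast two_pow_le_primorial_32768)
    rw [primeCounting_32768]
    push_cast at h ⊢
    rw [l15]
    linarith [log_two_lt_d9]
  | succ n hn ih =>
    have hn' : (32768 : ℝ) ≤ n := by exact_mod_cast hn
    have hlog : 10 ≤ log n := by
      have := log_le_log (by norm_num) hn'
      linarith
    have hA := theta_le hn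
    have hstep : Nat.primeCounting (n + 1) * log (n + 1 : ℕ) - Chebyshev.theta (n + 1 : ℕ) =
        Nat.primeCounting n * log (n + 1 : ℕ) - Chebyshev.theta n := by
      rw [theta_succ, primeCounting_succ]
      split_ifs <;> push_cast <;> ring
    have hinc : (log (n + 1 : ℕ) - log n) * n ≤ 1 := by
      have h := log_le_sub_one_of_pos (x := ((n + 1 : ℕ) : ℝ) / n) (by positivity)
      rw [log_div (by positivity) (by positivity)] at h
      have h₂ : ((n + 1 : ℕ) : ℝ) / n - 1 = 1 / n := by
        push_cast; field_simp; ring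
      rwa [h₂, le_div_iff₀ (by linarith)] at h
    have hmono : 0 ≤ log (n + 1 : ℕ) - log n := sub_nonneg.2 <|
      log_le_log (by linarith) (by push_cast; linarith)
    have hπ : (Nat.primeCounting n : ℝ) ≤ 0.13 * n := by
      have : (Nat.primeCounting n : ℝ) * 10 ≤ Nat.primeCounting n * log n := by gcongr
      linarith
    rw [hstep]
    push_cast at *
    nlinarith [mul_le_mul_of_nonneg_right hπ hmono]

theorem primeCounting_mul_log_le {n : ℕ} (hn : 32768 ≤ n) :
    Nat.primeCounting n * log n ≤ 1.242 * n := by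
  have := primeCounting_mul_log_sub_theta_le hn
  have := theta_le hn
  linarith

theorem le_primeCounting_mul_log {n : ℕ} (hn : 100000 ≤ n) :
    0.92 * n ≤ Nat.primeCounting n * log n := by
  have hn' : (100000 : ℝ) ≤ n := by exact_mod_cast hn
  have h₁ := (chebyshevCombination_bounds (by omega : 30 ≤ n)).1
  have h₂ := chebyshevCombination_le_psi n
  have h₃ := Chebyshev.psi_le_primeCounting_mul_log n
  have h₄ := log_le_div_two_pow (by linarith : (0 : ℝ) < n) 16
  have := log_two_lt_d9
  norm_num at h₁ h₄ ⊢
  linarith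

theorem primeCounting_mul_le_of_le_add {x y : ℕ} (hxy : y ≤ x) (h : 100000 ≤ x + y) :
    (Nat.primeCounting x : ℝ) * Nat.primeCounting y ≤
      (9 / 16) * (Nat.primeCounting (x + y) : ℝ) ^ 2 := by
  obtain ⟨N, hN⟩ : ∃ N, N = x + y := ⟨_, rfl⟩
  rw [← hN] at h ⊢
  have hN' : (100000 : ℝ) ≤ N := by exact_mod_cast h
  have hNxy : (N : ℝ) = x + y := by exact_mod_cast hN
  have := log_two_lt_d9
  have := log_three_lt_d9
  have hL : 11.5 ≤ log N := by
    have h₁ := log_le_log (by norm_num) hN'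
    have h₂ : log 100000 = 5 * (log 2 + log 5) := by
      rw [← log_mul (by norm_num) (by norm_num), show (100000 : ℝ) = (2 * 5) ^ 5 by norm_num,
        log_pow]
      norm_num
    have := log_two_gt_d9
    have := log_five_gt_d9
    norm_num at *
    linarith
  have hlow := le_primeCounting_mul_log h
  have log_ge (k m : ℕ) (hk : 0 < k) (hm : N ≤ k * m) : log N - log k ≤ log m := by
    have hm₀ : 0 < m := by
      rcases Nat.eq_zero_or_pos m with rfl | hm₀
      · omega
      · exact hm₀
    rw [sub_le_iff_le_add, ← log_mul (by positivity) (by positivity)]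
    exact log_le_log (by linarith) (by rw [mul_comm]; exact_mod_cast hm)
  rcases le_or_gt (3 * y) N with hy | hy
  · have hm := primeCounting_mul_log_le (n := N / 3) (by omega)
    have hlog := log_ge 4 (N / 3) (by norm_num) (by omega)
    have hle : ((N / 3 : ℕ) : ℝ) ≤ (N : ℝ) / (3 : ℕ) := Nat.cast_div_le
    have hx : (Nat.primeCounting x : ℝ) ≤ Nat.primeCounting N := by
      exact_mod_cast Nat.monotone_primeCounting (by omega)
    have hy : (Nat.primeCounting y : ℝ) ≤ Nat.primeCounting (N / 3) := by
      exact_mod_cast Nat.monotone_primeCounting (by omega)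
    have l4 : log (4 : ℕ) = 2 * log 2 := by
      rw [show ((4 : ℕ) : ℝ) = 2 ^ 2 by norm_num, log_pow]; norm_num
    rw [l4] at hlog
    push_cast at hle
    have key : (Nat.primeCounting (N / 3) : ℝ) ≤ 9 / 16 * Nat.primeCounting N := by
      have h₁ : (Nat.primeCounting (N / 3) : ℝ) * (0.8 * log N) ≤
          Nat.primeCounting (N / 3) * log (N / 3 : ℕ) := by
        gcongr
        norm_num at *
        linarith
      have h₂ : Nat.primeCounting (N / 3) * log N ≤ (9 / 16 * Nat.primeCounting N) * log N := by
        norm_num at *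
        linarith
      exact le_of_mul_le_mul_right h₂ (by norm_num at *; linarith)
    calc (Nat.primeCounting x : ℝ) * Nat.primeCounting y
        ≤ Nat.primeCounting N * (9 / 16 * Nat.primeCounting N) := by
          gcongr
          exact hy.trans key
      _ = _ := by ring
  · have hx := primeCounting_mul_log_le (n := x) (by omega)
    have hy := primeCounting_mul_log_le (n := y) (by omega)
    have hlx := log_ge 2 x (by norm_num) (by omega)
    have hly := log_ge 3 y (by norm_num) (by omega)
    push_cast at hlx hly
    generalize log (N : ℝ) = L at *
    have hlogs : 0.84 * L ^ 2 ≤ log x * log y := by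
      have h₁ : 0.939 * L ≤ log x := by norm_num at *; linarith
      have h₂ : 0.904 * L ≤ log y := by norm_num at *; linarith
      have h₀ : 0 ≤ L := by norm_num at *; linarith
      have := mul_le_mul h₁ h₂ (by positivity) (by linarith)
      norm_num at *
      nlinarith
    have hL₀ : 0 < L := by norm_num at *; linarith
    have h₁ : (Nat.primeCounting x * log x) * (Nat.primeCounting y * log y) ≤
        (1.242 * x) * (1.242 * y) :=
      mul_le_mul hx hy (mul_nonneg (by positivity) (log_natCast_nonneg y)) (by positivity)
    have h₂ : (0.92 * (N : ℝ)) ^ 2 ≤ (Nat.primeCounting N * L) ^ 2 :=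
      pow_le_pow_left₀ (by positivity) hlow 2
    have h₃ : (x : ℝ) * y ≤ N ^ 2 / 4 := by
      rw [hNxy]; nlinarith [sq_nonneg ((x : ℝ) - y)]
    have h₄ : (Nat.primeCounting x : ℝ) * Nat.primeCounting y * (0.84 * L ^ 2) ≤
        Nat.primeCounting x * Nat.primeCounting y * (log x * log y) := by gcongr
    have h₅ : (Nat.primeCounting x : ℝ) * Nat.primeCounting y * L ^ 2 ≤
        9 / 16 * (Nat.primeCounting N : ℝ) ^ 2 * L ^ 2 := by
      norm_num at *
      nlinarith
    exact le_of_mul_le_mul_right h₅ (by positivity)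

/-- Alzer–Kwong–Sándor (2022): for all integers `x, y ≥ 2`,
`π(x) π(y) ≤ (9/16) π(x+y)²`. -/
theorem alzer_kwong_sandor_primeCounting (x y : ℕ) (hx : 2 ≤ x) (hy : 2 ≤ y) :
    (Nat.primeCounting x : ℝ) * (Nat.primeCounting y : ℝ) ≤
      (9 / 16) * (Nat.primeCounting (x + y) : ℝ) ^ 2 := by
  rcases lt_or_ge (x + y) 100000 with h | h
  · have key : (16 * (Nat.primeCounting x * Nat.primeCounting y) : ℝ) ≤
        9 * (Nat.primeCounting (x + y) : ℝ) ^ 2 := by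
      exact_mod_cast primeCounting_mul_le_of_add_lt hx hy h
    linarith
  · rcases le_total y x with hxy | hxy
    · exact primeCounting_mul_le_of_le_add hxy h
    · rw [mul_comm, add_comm]
      exact primeCounting_mul_le_of_le_add hxy (by omega)
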